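/- Let k ≥ 1 and let s, l be integers with 1 ≤ s < l ≤ k+1. If s ≥ 2 then (x_l − x_s) (∏_{i=s+1}^{l} x_i) (∏_{i=l+1}^{k} x_i²) ≈₂ q (x_{l−1} − x_{s−1}) (∏_{i=s}^{l−1} x_i) (∏_{i=l}^{k} x_i²), and if s = 1 then (x_l − x_1) (∏_{i=2}^{l} x_i) (∏_{i=l+1}^{k} x_i²) ≈₂ (1 + q x_{l−1}) (∏_{i=1}^{l−1} x_i) (∏_{i=l}^{k} x_i²); here by convention x_j = 0 for j < 1 and x_j = 1 for j > k, and empty products equal 1. -/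

import Mathlib

open PowerSeries

noncomputable section

/-- The product (coefficientwise) topology on `ℚ⟦X⟧`. -/
instance : TopologicalSpace ℚ⟦X⟧ :=
  inferInstanceAs (TopologicalSpace ((Unit →₀ ℕ) → ℚ))

/-- `(q)_n = ∏_{i=1}^n (1 - q^i)` in `ℚ⟦X⟧`. -/
def qp (n : ℕ) : ℚ⟦X⟧ := ∏ i ∈ Finset.range n, (1 - X ^ (i + 1))

/-- `(-q)_n = ∏_{i=1}^n (1 + q^i)` in `ℚ⟦X⟧`. -/
def nqp (n : ℕ) : ℚ⟦X⟧ := ∏ i ∈ Finset.range n, (1 + X ^ (i + 1))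

/-- The Gaussian binomial `[M, N]_q`, zero unless `M ≥ N`. -/
def qbinom (M N : ℕ) : ℚ⟦X⟧ :=
  if N ≤ M then qp M * ((qp N)⁻¹ * (qp (M - N))⁻¹) else 0

/-- Weakly decreasing tuples `f 0 ≥ f 1 ≥ … ≥ f (r-1) ≥ 0`, encoded as
antitone functions `ℕ → ℕ` vanishing from index `r` on. -/
def DecTuple (r : ℕ) : Type :=
  {f : ℕ → ℕ // (∀ ⦃i j : ℕ⦄, i ≤ j → f j ≤ f i) ∧ ∀ i, r ≤ i → f i = 0}

/-- `(q)_λ = (q)_{λ_1-λ_2} ⋯ (q)_{λ_{r-1}-λ_r} (q)_{λ_r}` for a weakly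
decreasing tuple `λ` (0-indexed). -/
def qpT (r : ℕ) (f : ℕ → ℕ) : ℚ⟦X⟧ := ∏ i ∈ Finset.range r, qp (f i - f (i + 1))


/-- The variable `x_j` (1-indexed, `1 ≤ j ≤ r`) of `ℤ[x_1,…,x_r,q]`, with the
conventions `x_j = 0` for `j < 1` and `x_j = 1` for `j > r`. -/
def xv (r j : ℕ) : MvPolynomial (Fin (r + 1)) ℤ :=
  if h : 1 ≤ j ∧ j ≤ r then MvPolynomial.X ⟨j - 1, by omega⟩
  else if j = 0 then 0 else 1

/-- The variable `q` of `ℤ[x_1,…,x_r,q]`. -/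
def qv (r : ℕ) : MvPolynomial (Fin (r + 1)) ℤ := MvPolynomial.X (Fin.last r)

/-- Evaluation of `P ∈ ℤ[x_1,…,x_r,q]` at `x_j = q^{λ_j}` and `q = X` in
`ℚ⟦X⟧`; here `f` is the 0-indexed tuple `(λ_1, …, λ_r)`. -/
def pEval (r : ℕ) (f : ℕ → ℕ) (P : MvPolynomial (Fin (r + 1)) ℤ) : ℚ⟦X⟧ :=
  MvPolynomial.aeval
    (fun i : Fin (r + 1) => if (i : ℕ) < r then (X : ℚ⟦X⟧) ^ f i else X) P

/-- The relation `P ≈₂ Q`: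
`Σ_{λ_1 ≥ … ≥ λ_k ≥ 0} (-q)_{λ_1} q^{λ_1(λ_1-1)/2 + Σ_{i=2}^k λ_i²}/(q)_λ ·
  (P(q^{λ_1},…,q^{λ_k},q) - Q(q^{λ_1},…,q^{λ_k},q)) = 0`. -/
def papprox2 (k : ℕ) (P Q : MvPolynomial (Fin (k + 1)) ℤ) : Prop :=
  ∑' f : DecTuple k,
    nqp (f.1 0) *
        (X : ℚ⟦X⟧) ^ (f.1 0 * (f.1 0 - 1) / 2 + ∑ i ∈ Finset.Ico 1 k, f.1 i ^ 2) *
        (qpT k f.1)⁻¹ *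
      (pEval k f.1 P - pEval k f.1 Q) = 0

section Telescoping

variable {A : Type*} [CommRing A]

theorem sum_Ico_sub_mul_prod_erase (x : ℕ → A) {s l : ℕ} (h : s ≤ l) :
    ∑ j ∈ Finset.Ico s l, (x (j + 1) - x j) *
        ((∏ i ∈ Finset.Ico s j, x i) * ∏ i ∈ Finset.Ico (j + 2) (l + 1), x i) =
      (∏ i ∈ Finset.Ico (s + 1) (l + 1), x i) - ∏ i ∈ Finset.Ico s l, x i := by
  let u : ℕ → A := fun n =>
    -((∏ i ∈ Finset.Ico s n, x i) * ∏ i ∈ Finset.Ico (n + 1) (l + 1), x i)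
  have key : ∀ j ∈ Finset.Ico s l, (x (j + 1) - x j) *
        ((∏ i ∈ Finset.Ico s j, x i) * ∏ i ∈ Finset.Ico (j + 2) (l + 1), x i) =
      u (j + 1) - u j := by
    intro j hj
    rw [Finset.mem_Ico] at hj
    simp only [u]
    rw [Finset.prod_Ico_succ_top hj.1,
      Finset.prod_eq_prod_Ico_succ_bot (show j + 1 < l + 1 by omega)]
    ring
  rw [Finset.sum_congr rfl key, Finset.sum_Ico_sub u h]
  simp [u]
  ring

theorem prod_Ico_eq_mul_mul (x : ℕ → A) {s j l : ℕ} (hs : s ≤ j) (hl : j < l) :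
    ∏ i ∈ Finset.Ico s (l + 1), x i =
      x j * x (j + 1) *
        ((∏ i ∈ Finset.Ico s j, x i) * ∏ i ∈ Finset.Ico (j + 2) (l + 1), x i) := by
  rw [← Finset.prod_Ico_consecutive x hs (show j ≤ l + 1 by omega),
    Finset.prod_eq_prod_Ico_succ_bot (show j < l + 1 by omega),
    Finset.prod_eq_prod_Ico_succ_bot (show j + 1 < l + 1 by omega)]
  ring

theorem sum_Ico_mul_sub_add_ite (x : ℕ → A) (q : A) {s l : ℕ} (hs : 1 ≤ s) (h : s < l) :
    ∑ j ∈ Finset.Ico s l, (q * (x j - x (j - 1)) + if j = 1 then 1 else 0) =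
      q * (x (l - 1) - x (s - 1)) + if s = 1 then 1 else 0 := by
  induction l, h using Nat.le_induction with
  | base => simp
  | succ l hl ih =>
    rw [Finset.sum_Ico_succ_top (by omega), ih, if_neg (show l ≠ 1 by omega)]
    simp only [Nat.add_sub_cancel]
    ring

end Telescoping

theorem qp_succ (n : ℕ) : qp (n + 1) = qp n * (1 - X ^ (n + 1)) :=
  Finset.prod_range_succ _ _

theorem nqp_succ (n : ℕ) : nqp (n + 1) = nqp n * (1 + X ^ (n + 1)) :=
  Finset.prod_range_succ _ _

theorem constantCoeff_qp (n : ℕ) : constantCoeff (qp n) = 1 := by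
  simp [qp, map_prod]

theorem constantCoeff_qpT (k : ℕ) (f : ℕ → ℕ) : constantCoeff (qpT k f) = 1 := by
  simp [qpT, map_prod, constantCoeff_qp]

namespace DecTuple

variable {k : ℕ}

theorem ext_of_lt {f g : DecTuple k} (h : ∀ i, i < k → f.1 i = g.1 i) : f = g := by
  apply Subtype.ext
  funext i
  by_cases hi : i < k
  · exact h i hi
  · rw [f.2.2 i (by omega), g.2.2 i (by omega)]

theorem finite_head_le (k N : ℕ) : {f : DecTuple k | f.1 0 ≤ N}.Finite := by
  let φ : {f : DecTuple k | f.1 0 ≤ N} → (Fin k → Fin (N + 1)) :=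
    fun f i => ⟨f.1.1 i, Nat.lt_succ_of_le ((f.1.2.1 (Nat.zero_le _)).trans f.2)⟩
  have hφ : Function.Injective φ := by
    intro f g h
    apply Subtype.ext
    apply ext_of_lt
    intro i hi
    have := congrFun h ⟨i, hi⟩
    simpa [φ] using this
  exact Set.finite_coe_iff.mp (Finite.of_injective φ hφ)

/-- The weight of a tuple in the sums defining `papprox2`. -/
def weight (f : DecTuple k) : ℚ⟦X⟧ :=
  nqp (f.1 0) *
    (X : ℚ⟦X⟧) ^ (f.1 0 * (f.1 0 - 1) / 2 + ∑ i ∈ Finset.Ico 1 k, f.1 i ^ 2) *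
    (qpT k f.1)⁻¹

/-- The value `q ^ λ_j` of the variable `x_j` at a tuple, with `x_0 = 0`. -/
def value (f : DecTuple k) (j : ℕ) : ℚ⟦X⟧ := if j = 0 then 0 else X ^ f.1 (j - 1)

theorem value_succ (f : DecTuple k) (j : ℕ) : f.value (j + 1) = X ^ f.1 j := by
  simp [value]

theorem pEval_xv (f : DecTuple k) (j : ℕ) : pEval k f.1 (xv k j) = f.value j := by
  unfold pEval xv value
  split_ifs with h h0 h0
  · omega
  · rw [MvPolynomial.aeval_X, if_pos (show j - 1 < k by omega)]
  · simp
  · rw [f.2.2 (j - 1) (by omega)]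
    simp

theorem pEval_qv (f : DecTuple k) : pEval k f.1 (qv k) = X := by
  simp [pEval, qv]

instance : T2Space ℚ⟦X⟧ := inferInstanceAs (T2Space ((Unit →₀ ℕ) → ℚ))

instance : IsTopologicalAddGroup ℚ⟦X⟧ :=
  inferInstanceAs (IsTopologicalAddGroup ((Unit →₀ ℕ) → ℚ))

theorem summable_weight_mul (G : DecTuple k → ℚ⟦X⟧) :
    Summable fun f : DecTuple k => f.weight * G f := by
  have key : ∀ n : Unit →₀ ℕ, Summable fun f : DecTuple k =>
      (show (Unit →₀ ℕ) → ℚ from f.weight * G f) n := by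
    intro n
    apply summable_of_hasFiniteSupport
    apply (finite_head_le k (n () + 2)).subset
    intro f hf
    by_contra hlt
    simp only [Set.mem_ofPred_eq, not_le] at hlt
    apply hf
    have hle : n () < f.1 0 * (f.1 0 - 1) / 2 := by
      rw [Nat.lt_iff_add_one_le, Nat.le_div_iff_mul_le (by norm_num)]
      obtain ⟨m, hm⟩ : ∃ m, f.1 0 = m + 1 := ⟨f.1 0 - 1, by omega⟩
      rw [hm, Nat.add_sub_cancel]
      nlinarith
    have hdvd : (X : ℚ⟦X⟧) ^ (n () + 1) ∣ f.weight * G f := by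
      unfold weight
      apply Dvd.dvd.mul_right
      apply Dvd.dvd.mul_right
      apply Dvd.dvd.mul_left
      exact pow_dvd_pow _ (by omega)
    have := (X_pow_dvd_iff.mp hdvd) (n ()) (by omega)
    rw [coeff_def (s := n) rfl] at this
    exact this
  exact Pi.summable.mpr key

/-- The tuple with its entry `i` raised by one, given that it stays decreasing. -/
def bump (f : DecTuple k) (i : ℕ) (hi : i < k) (h : ∀ r, r + 1 = i → f.1 i < f.1 r) :
    DecTuple k :=
  ⟨Function.update f.1 i (f.1 i + 1), by
    refine ⟨antitone_nat_of_succ_le fun r => ?_, fun r hr => ?_⟩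
    · have := f.2.1 (Nat.le_succ r)
      by_cases h1 : r + 1 = i
      · subst h1
        have := h r rfl
        simpa using this
      · rw [Function.update_of_ne h1]
        by_cases h2 : r = i
        · subst h2
          simpa using this.trans (Nat.le_succ _)
        · rwa [Function.update_of_ne h2]
    · rw [Function.update_of_ne (by omega)]
      exact f.2.2 r hr⟩

theorem qpT_bump (f : DecTuple k) {i : ℕ} (hi : i < k) (h : ∀ r, r + 1 = i → f.1 i < f.1 r) :
    qpT k (f.bump i hi h).1 * (if i = 0 then 1 else 1 - X ^ (f.1 (i - 1) - f.1 i)) =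
      qpT k f.1 * (1 - X ^ (f.1 i + 1 - f.1 (i + 1))) := by
  have h1 : ∀ r ∈ Finset.range k,
      qp ((f.bump i hi h).1 r - (f.bump i hi h).1 (r + 1)) *
          (if r + 1 = i then 1 - X ^ (f.1 (i - 1) - f.1 i) else 1) =
        qp (f.1 r - f.1 (r + 1)) *
          (if r = i then 1 - X ^ (f.1 i + 1 - f.1 (i + 1)) else 1) := by
    intro r _
    have hm := f.2.1 (Nat.le_succ r)
    simp only [bump]
    by_cases hr : r = i
    · subst hr
      rw [if_neg (by omega), if_pos rfl, Function.update_self, Function.update_of_ne (by omega),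
        mul_one, Nat.succ_sub hm, qp_succ]
    · rw [Function.update_of_ne hr, if_neg hr, mul_one]
      by_cases hr1 : r + 1 = i
      · subst hr1
        have := h r rfl
        rw [Function.update_self, if_pos rfl, Nat.add_sub_cancel]
        obtain ⟨d, hd⟩ : ∃ d, f.1 r = f.1 (r + 1) + d + 1 := ⟨f.1 r - f.1 (r + 1) - 1, by omega⟩
        rw [hd, show f.1 (r + 1) + d + 1 - (f.1 (r + 1) + 1) = d by omega,
          show f.1 (r + 1) + d + 1 - f.1 (r + 1) = d + 1 by omega, qp_succ]
      · rw [Function.update_of_ne hr1, if_neg hr1, mul_one]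
  have h2 := Finset.prod_congr rfl h1
  rw [Finset.prod_mul_distrib, Finset.prod_mul_distrib, Finset.prod_ite_eq' (Finset.range k) i,
    if_pos (Finset.mem_range.mpr hi)] at h2
  unfold qpT
  rw [← h2]
  congr 1
  rcases i with _ | i
  · simp
  · simp only [Nat.add_right_cancel_iff, Nat.add_sub_cancel, if_neg (Nat.succ_ne_zero i)]
    rw [Finset.prod_ite_eq' (Finset.range k) i, if_pos (Finset.mem_range.mpr (by omega))]

theorem inv_qpT_bump (f : DecTuple k) {i : ℕ} (hi : i < k)
    (h : ∀ r, r + 1 = i → f.1 i < f.1 r) :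
    (qpT k (f.bump i hi h).1)⁻¹ * (1 - X ^ (f.1 i + 1 - f.1 (i + 1))) =
      (qpT k f.1)⁻¹ * (if i = 0 then 1 else 1 - X ^ (f.1 (i - 1) - f.1 i)) := by
  have h1 := PowerSeries.mul_inv_cancel (qpT k f.1) (by simp [constantCoeff_qpT])
  have h2 := PowerSeries.mul_inv_cancel (qpT k (f.bump i hi h).1) (by simp [constantCoeff_qpT])
  have h3 := qpT_bump f hi h
  linear_combination (-(qpT k (f.bump i hi h).1)⁻¹ * (1 - X ^ (f.1 i + 1 - f.1 (i + 1)))) * h1 +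
    ((qpT k f.1)⁻¹ * (if i = 0 then 1 else 1 - X ^ (f.1 (i - 1) - f.1 i))) * h2 -
    (qpT k (f.bump i hi h).1)⁻¹ * (qpT k f.1)⁻¹ * h3

theorem weight_bump (f : DecTuple k) {i : ℕ} (hi : i < k)
    (h : ∀ r, r + 1 = i → f.1 i < f.1 r) :
    (f.bump i hi h).weight * ((f.bump i hi h).value (i + 2) - (f.bump i hi h).value (i + 1)) =
      f.weight * ((X * (f.value (i + 1) - f.value i) + if i = 0 then 1 else 0) *
        (f.value (i + 1) * f.value (i + 2))) := by
  have hT := inv_qpT_bump f hi h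
  have hm : f.1 (i + 1) ≤ f.1 i := f.2.1 (Nat.le_succ i)
  have e1 : (f.bump i hi h).value (i + 2) - (f.bump i hi h).value (i + 1) =
      X ^ f.1 (i + 1) * (1 - X ^ (f.1 i + 1 - f.1 (i + 1))) := by
    rw [value_succ, value_succ, mul_sub, ← pow_add, Nat.add_sub_cancel' (by omega)]
    simp [bump]
  rw [e1, value_succ, value_succ]
  unfold weight
  rcases i with _ | i
  · have e2 : (f.bump 0 hi h).1 0 = f.1 0 + 1 := by simp [bump]
    have e3 : ∑ i ∈ Finset.Ico 1 k, (f.bump 0 hi h).1 i ^ 2 = ∑ i ∈ Finset.Ico 1 k, f.1 i ^ 2 := by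
      refine Finset.sum_congr rfl fun r hr => ?_
      rw [Finset.mem_Ico] at hr
      simp only [bump]
      rw [Function.update_of_ne (by omega)]
    have e4 : (f.1 0 + 1) * (f.1 0 + 1 - 1) / 2 = f.1 0 * (f.1 0 - 1) / 2 + f.1 0 := by
      exact Nat.triangle_succ _
    rw [e2, e3, e4, nqp_succ]
    simp only [if_true, mul_one, zero_add, value] at hT ⊢
    rw [pow_add, pow_add, pow_add, pow_succ]
    linear_combination (nqp (f.1 0) * (1 + X ^ f.1 0 * X) * X ^ (f.1 0 * (f.1 0 - 1) / 2) *
      X ^ f.1 0 * X ^ (∑ i ∈ Finset.Ico 1 k, f.1 i ^ 2) * X ^ f.1 1) * hT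
  · have e2 : (f.bump (i + 1) hi h).1 0 = f.1 0 := by simp [bump]
    have e3 : ∑ r ∈ Finset.Ico 1 k, (f.bump (i + 1) hi h).1 r ^ 2 =
        ∑ r ∈ Finset.Ico 1 k, f.1 r ^ 2 + (2 * f.1 (i + 1) + 1) := by
      have hmem : i + 1 ∈ Finset.Ico 1 k := Finset.mem_Ico.mpr (by omega)
      rw [← Finset.add_sum_erase _ _ hmem, ← Finset.add_sum_erase _ _ hmem]
      have : ∑ r ∈ (Finset.Ico 1 k).erase (i + 1), (f.bump (i + 1) hi h).1 r ^ 2 =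
          ∑ r ∈ (Finset.Ico 1 k).erase (i + 1), f.1 r ^ 2 := by
        refine Finset.sum_congr rfl fun r hr => ?_
        simp only [bump]
        rw [Function.update_of_ne (Finset.ne_of_mem_erase hr)]
      rw [this]
      simp only [bump, Function.update_self]
      ring
    have e4 : (X : ℚ⟦X⟧) ^ f.1 i = X ^ f.1 (i + 1) * X ^ (f.1 i - f.1 (i + 1)) := by
      rw [← pow_add, Nat.add_sub_cancel' (f.2.1 (Nat.le_succ i))]
    rw [e2, e3, value_succ, e4]
    simp only [Nat.add_sub_cancel, if_neg (Nat.succ_ne_zero i), add_zero] at hT ⊢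
    rw [← add_assoc, pow_add _ _ (2 * f.1 (i + 1) + 1), pow_succ, two_mul, pow_add _ (f.1 (i + 1))]
    linear_combination (nqp (f.1 0) *
      X ^ (f.1 0 * (f.1 0 - 1) / 2 + ∑ i ∈ Finset.Ico 1 k, f.1 i ^ 2) *
      X ^ f.1 (i + 1) * X ^ f.1 (i + 1) * X * X ^ f.1 (i + 1 + 1)) * hT

/-- Raising the entry `λ_{i+1}` by one: the contiguous relation behind `papprox2`. -/
theorem tsum_weight_mul_value_sub {i : ℕ} (hi : i < k) (F : DecTuple k → ℚ⟦X⟧)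
    (hF : ∀ f g : DecTuple k, (∀ r, r ≠ i → f.1 r = g.1 r) → F f = F g) :
    ∑' f : DecTuple k, f.weight * ((f.value (i + 2) - f.value (i + 1)) * F f) =
      ∑' f : DecTuple k, f.weight * ((X * (f.value (i + 1) - f.value i) + if i = 0 then 1 else 0) *
        (f.value (i + 1) * f.value (i + 2)) * F f) := by
  have hb : ∀ f : DecTuple k,
      f.weight * ((X * (f.value (i + 1) - f.value i) + if i = 0 then 1 else 0) *
        (f.value (i + 1) * f.value (i + 2)) * F f) ≠ 0 → ∀ r, r + 1 = i → f.1 i < f.1 r := by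
    rintro f hf r rfl
    refine lt_of_le_of_ne (f.2.1 (Nat.le_succ r)) fun he => hf ?_
    rw [value_succ, value_succ, he]
    simp
  refine tsum_eq_tsum_of_ne_zero_bij (fun f => f.1.bump i hi (hb f.1 f.2)) ?_ ?_ ?_
  · intro f g hfg
    apply Subtype.ext
    apply Subtype.ext
    funext r
    have := congrFun (congrArg Subtype.val hfg) r
    simp only [bump] at this
    by_cases hr : r = i
    · subst hr
      simpa using this
    · simpa [Function.update_of_ne hr] using this
  · intro g hg
    have hlt : g.1 (i + 1) < g.1 i := by
      refine lt_of_le_of_ne (g.2.1 (Nat.le_succ i)) fun he => hg ?_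
      simp [value_succ, he]
    let f : DecTuple k := ⟨Function.update g.1 i (g.1 i - 1), by
      refine ⟨antitone_nat_of_succ_le fun r => ?_, fun r hr => ?_⟩
      · have : g.1 (r + 1) ≤ g.1 r := g.2.1 (Nat.le_succ r)
        by_cases h1 : r + 1 = i
        · subst h1
          rw [Function.update_self, Function.update_of_ne (by omega)]
          exact (Nat.sub_le _ _).trans this
        · rw [Function.update_of_ne h1]
          by_cases h2 : r = i
          · subst h2
            rw [Function.update_self]
            omega
          · rwa [Function.update_of_ne h2]
      · rw [Function.update_of_ne (by omega)]
        exact g.2.2 r hr⟩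
    have hfi : f.1 i = g.1 i - 1 := by simp [f]
    have hfr : ∀ r, r ≠ i → f.1 r = g.1 r := fun r hr => by simp [f, Function.update_of_ne hr]
    have hf : ∀ r, r + 1 = i → f.1 i < f.1 r := by
      rintro r rfl
      rw [hfi, hfr r (by omega)]
      have : g.1 (r + 1) ≤ g.1 r := g.2.1 (Nat.le_succ r)
      omega
    have hfg : f.bump i hi hf = g := by
      apply Subtype.ext
      funext r
      simp only [bump]
      by_cases hr : r = i
      · subst hr
        rw [Function.update_self, hfi]
        omega
      · rw [Function.update_of_ne hr, hfr r hr]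
    refine ⟨⟨f, ?_⟩, hfg⟩
    rw [Function.mem_support, ← mul_assoc, ← weight_bump f hi hf, hF f g hfr, hfg, mul_assoc]
    exact hg
  · intro f
    have hF' : F (f.1.bump i hi (hb f.1 f.2)) = F f.1 :=
      hF _ _ fun r hr => by simp [bump, Function.update_of_ne hr]
    rw [hF', ← mul_assoc, weight_bump, mul_assoc]

theorem papprox2_of_eq {s l : ℕ} (hs : 1 ≤ s) (hsl : s < l) (hl : l ≤ k + 1)
    {P Q : MvPolynomial (Fin (k + 1)) ℤ}
    (hP : ∀ f : DecTuple k, pEval k f.1 P =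
      (f.value l - f.value s) * (∏ i ∈ Finset.Icc (s + 1) l, f.value i) *
        ∏ i ∈ Finset.Icc (l + 1) k, f.value i ^ 2)
    (hQ : ∀ f : DecTuple k, pEval k f.1 Q =
      (X * (f.value (l - 1) - f.value (s - 1)) + if s = 1 then 1 else 0) *
        (∏ i ∈ Finset.Icc s (l - 1), f.value i) * ∏ i ∈ Finset.Icc l k, f.value i ^ 2) :
    papprox2 k P Q := by
  let F : ℕ → DecTuple k → ℚ⟦X⟧ := fun j f =>
    ((∏ i ∈ Finset.Ico s j, f.value i) * ∏ i ∈ Finset.Ico (j + 2) (l + 1), f.value i) *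
      (f.value l * ∏ i ∈ Finset.Icc (l + 1) k, f.value i ^ 2)
  have hd : ∀ f : DecTuple k, pEval k f.1 P - pEval k f.1 Q =
      ∑ j ∈ Finset.Ico s l, ((f.value (j + 1) - f.value j) * F j f -
        (X * (f.value j - f.value (j - 1)) + if j = 1 then 1 else 0) *
          (f.value j * f.value (j + 1)) * F j f) := by
    intro f
    have h1 := sum_Ico_sub_mul_prod_erase f.value hsl.le
    have h2 := sum_Ico_mul_sub_add_ite f.value X hs hsl
    have h3 : ∀ j ∈ Finset.Ico s l,
        (X * (f.value j - f.value (j - 1)) + if j = 1 then 1 else 0) *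
          (f.value j * f.value (j + 1)) * F j f =
        (X * (f.value j - f.value (j - 1)) + if j = 1 then 1 else 0) *
          ((∏ i ∈ Finset.Ico s (l + 1), f.value i) *
            (f.value l * ∏ i ∈ Finset.Icc (l + 1) k, f.value i ^ 2)) := by
      intro j hj
      rw [Finset.mem_Ico] at hj
      rw [prod_Ico_eq_mul_mul f.value hj.1 hj.2]
      ring
    have h4 : ∏ i ∈ Finset.Icc l k, f.value i ^ 2 =
        f.value l ^ 2 * ∏ i ∈ Finset.Icc (l + 1) k, f.value i ^ 2 := by
      rcases hl.lt_or_eq with h | rfl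
      · rw [← Finset.mul_prod_Ioc_eq_prod_Icc (by omega), Finset.Icc_add_one_left_eq_Ioc]
      · rw [value_succ, f.2.2 k le_rfl]
        simp
    have h5 : Finset.Icc s (l - 1) = Finset.Ico s l := by
      ext
      simp
      omega
    have h6 : Finset.Icc (s + 1) l = Finset.Ico (s + 1) (l + 1) := by
      ext
      simp
    rw [Finset.sum_sub_distrib, Finset.sum_congr rfl h3, ← Finset.sum_mul, h2]
    simp only [F, ← mul_assoc]
    simp only [← Finset.sum_mul]
    simp only [mul_assoc] at h1 ⊢
    rw [h1, hP, hQ, h4, h5, h6, Finset.prod_Ico_succ_top hsl.le,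
      Finset.prod_Ico_succ_top (show s + 1 ≤ l by omega),
      Finset.prod_eq_prod_Ico_succ_bot hsl]
    ring
  have hsum : ∀ G : DecTuple k → ℚ⟦X⟧, Summable fun f : DecTuple k => f.weight * G f :=
    summable_weight_mul
  change ∑' f : DecTuple k, f.weight * (pEval k f.1 P - pEval k f.1 Q) = 0
  simp only [hd, Finset.mul_sum]
  rw [Summable.tsum_finsetSum fun j _ => hsum _]
  refine Finset.sum_eq_zero fun j hj => ?_
  rw [Finset.mem_Ico] at hj
  simp only [mul_sub (weight _)]
  rw [(hsum _).tsum_sub (hsum _), sub_eq_zero]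
  obtain ⟨i, rfl⟩ : ∃ i, j = i + 1 := ⟨j - 1, by omega⟩
  simp only [Nat.add_sub_cancel, Nat.add_eq_right]
  refine tsum_weight_mul_value_sub (by omega) (F (i + 1)) fun f g hfg => ?_
  have hv : ∀ m, m ≠ i + 1 → f.value m = g.value m := by
    intro m hm
    unfold value
    split_ifs
    · rfl
    · rw [hfg (m - 1) (by omega)]
  have hp : ∀ S : Finset ℕ, (∀ m ∈ S, m ≠ i + 1) → ∀ e : ℕ,
      ∏ m ∈ S, f.value m ^ e = ∏ m ∈ S, g.value m ^ e :=
    fun S hS e => Finset.prod_congr rfl fun m hm => by rw [hv m (hS m hm)]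
  have hp1 := fun (S : Finset ℕ) hS => by simpa only [pow_one] using hp S hS 1
  simp only [F]
  rw [hv l (by omega), hp1 (Finset.Ico s (i + 1)), hp1 (Finset.Ico (i + 1 + 2) (l + 1)), hp _ _ 2]
  all_goals
    intro m hm
    simp only [Finset.mem_Ico, Finset.mem_Icc] at hm
    omega

end DecTuple

/-- Lemma `transformation2` (with `x_0 = 0`, `x_{k+1} = 1`). -/
theorem stmt14 (k s l : ℕ) (hk : 1 ≤ k) (hs : 1 ≤ s) (hsl : s < l) (hl : l ≤ k + 1) :
    (2 ≤ s →
      papprox2 k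
        ((xv k l - xv k s) * (∏ i ∈ Finset.Icc (s + 1) l, xv k i) *
          ∏ i ∈ Finset.Icc (l + 1) k, xv k i ^ 2)
        (qv k * (xv k (l - 1) - xv k (s - 1)) * (∏ i ∈ Finset.Icc s (l - 1), xv k i) *
          ∏ i ∈ Finset.Icc l k, xv k i ^ 2)) ∧
    (s = 1 →
      papprox2 k
        ((xv k l - xv k 1) * (∏ i ∈ Finset.Icc 2 l, xv k i) *
          ∏ i ∈ Finset.Icc (l + 1) k, xv k i ^ 2)
        ((1 + qv k * xv k (l - 1)) * (∏ i ∈ Finset.Icc 1 (l - 1), xv k i) *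
          ∏ i ∈ Finset.Icc l k, xv k i ^ 2)) := by
  have hxp := @DecTuple.pEval_xv k
  have hqp := @DecTuple.pEval_qv k
  unfold pEval at hxp hqp
  constructor
  · intro hs2
    refine DecTuple.papprox2_of_eq hs hsl hl (fun f => ?_) fun f => ?_
    · simp only [pEval, map_mul, map_sub, map_prod, map_pow, hxp]
    · simp only [pEval, map_mul, map_sub, map_prod, map_pow, hxp, hqp,
        if_neg (show s ≠ 1 by omega), add_zero]
  · rintro rfl
    refine DecTuple.papprox2_of_eq hs hsl hl (fun f => ?_) fun f => ?_
    · simp only [pEval, map_mul, map_sub, map_prod, map_pow, hxp]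
    · simp only [pEval, map_mul, map_add, map_one, map_prod, map_pow, hxp, hqp, if_true]
      simp [DecTuple.value, add_comm]
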